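/- arXiv:2310.05726 — 4 statements merged into one kernel-verified Lean document; each statement's English description precedes it below -/
import Mathlib

section
/- Let n ≥ 1 and d : Fin n → ℕ with d i ≥ 1 for every i, let s : Fin n → ℝ be any sign assignment with s i = 1 or s i = −1 for every i, and let α be a real number with |α| ≤ 1 / (max over i of d i). Then for every matrix C : Matrix ((i : Fin n) → Fin (d i)) ((i : Fin n) → Fin (d i)) ℂ one has ∑_{J ⊆ Fin n} α^{|J|} · (∏_{k ∈ J} s k) · ‖tr_J C‖₂² ≥ 0. (This is the positivity of every signed quadratic form q_v(α,C) associated to a universal state inversion, for |α| at most one over the maximal local dimension; it follows from the separability of Werner states in that range.) -/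
open Finset

/-- Squared Frobenius (Hilbert–Schmidt) norm of a complex matrix. -/
noncomputable def frobSq {m n : Type*} [Fintype m] [Fintype n] (M : Matrix m n ℂ) : ℝ :=
  ∑ p, ∑ q, ‖M p q‖ ^ 2

/-- Merge an assignment on a finset `J` with an assignment on its complement. -/
def mergeFun {n : ℕ} {d : Fin n → ℕ} (J : Finset (Fin n))
    (h : (i : {i : Fin n // i ∈ J}) → Fin (d i.1))
    (f : (i : {i : Fin n // i ∉ J}) → Fin (d i.1)) :
    (i : Fin n) → Fin (d i) :=
  fun i => if hi : i ∈ J then h ⟨i, hi⟩ else f ⟨i, hi⟩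

/-- Partial trace of a matrix on an `n`-partite system over the subsystems in `J`. -/
noncomputable def ptrace {n : ℕ} {d : Fin n → ℕ} (J : Finset (Fin n))
    (C : Matrix ((i : Fin n) → Fin (d i)) ((i : Fin n) → Fin (d i)) ℂ) :
    Matrix ((i : {i : Fin n // i ∉ J}) → Fin (d i.1))
      ((i : {i : Fin n // i ∉ J}) → Fin (d i.1)) ℂ :=
  Matrix.of fun f g =>
    ∑ h : (i : {i : Fin n // i ∈ J}) → Fin (d i.1), C (mergeFun J h f) (mergeFun J h g)

open scoped ComplexConjugate

/-- A tensor product of Gram kernels is positive semidefinite. -/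
lemma re_sum_prod_gram_nonneg {ι P : Type*} [Fintype ι] [DecidableEq ι] [Fintype P]
    {κ : ι → Type*} [∀ i, Fintype (κ i)] (e : P → ∀ i, κ i) (L : ∀ i, κ i → κ i → ℝ)
    (v : P → ℂ) :
    0 ≤ (∑ x, ∑ y, conj (v x) * v y *
      ∏ i, ((∑ z, L i z (e x i) * L i z (e y i) : ℝ) : ℂ)).re := by
  have h : (∑ x, ∑ y, conj (v x) * v y *
      ∏ i, ((∑ z, L i z (e x i) * L i z (e y i) : ℝ) : ℂ)) =
      ((∑ Z : ∀ i, κ i, Complex.normSq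
        (∑ x, v x * ((∏ i, L i (Z i) (e x i) : ℝ) : ℂ)) : ℝ) : ℂ) := by
    simp_rw [← Complex.ofReal_prod, Finset.prod_univ_sum, Fintype.piFinset_univ,
      Complex.ofReal_sum, Complex.normSq_eq_conj_mul_self, map_sum, Finset.sum_mul_sum,
      Finset.mul_sum]
    conv_lhs => enter [2, x]; rw [Finset.sum_comm]
    rw [Finset.sum_comm]
    refine Finset.sum_congr rfl fun Z _ => ?_
    refine Finset.sum_congr rfl fun x _ => Finset.sum_congr rfl fun y _ => ?_
    simp only [Finset.prod_mul_distrib, Complex.ofReal_mul, map_mul, Complex.conj_ofReal]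
    ring
  rw [h, Complex.ofReal_re]
  exact Finset.sum_nonneg fun Z _ => Complex.normSq_nonneg _

/-- The kernel `1 + β |Ω⟩⟨Ω|`, with `Ω` the unnormalized maximally entangled vector in dimension
`d`, is a Gram kernel when `-1 ≤ β * d`. -/
lemma exists_gram_one_add_maxEntangled {d : ℕ} (hd : 1 ≤ d) {β : ℝ} (hβ : -1 ≤ β * d) :
    ∃ L : Fin d × Fin d → Fin d × Fin d → ℝ, ∀ x y,
      ∑ z, L z x * L z y =
        β * ((if x.1 = x.2 then 1 else 0) * (if y.1 = y.2 then 1 else 0)) +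
          (if x.1 = y.1 then 1 else 0) * (if x.2 = y.2 then 1 else 0) := by
  have hd0 : (d : ℝ) ≠ 0 := by positivity
  obtain ⟨c, hc⟩ : ∃ c : ℝ, 2 * c + c ^ 2 * d = β := by
    refine ⟨(√(1 + β * d) - 1) / d, ?_⟩
    have := Real.sq_sqrt (show 0 ≤ 1 + β * d by linarith)
    field_simp
    linear_combination this
  refine ⟨fun z x => (if z.1 = x.1 then 1 else 0) * (if z.2 = x.2 then 1 else 0) +
    c * ((if z.1 = z.2 then 1 else 0) * (if x.1 = x.2 then 1 else 0)), ?_⟩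
  rintro ⟨a, b⟩ ⟨a', b'⟩
  have h1 : ∀ a b a' b' : Fin d, ∑ z : Fin d × Fin d,
      ((if z.1 = a then 1 else 0) * (if z.2 = b then 1 else 0) : ℝ) *
      ((if z.1 = a' then 1 else 0) * (if z.2 = b' then 1 else 0)) =
      (if a = a' then 1 else 0) * (if b = b' then 1 else 0) := by
    intro a b a' b'
    have h : ∀ a a' : Fin d, ∑ z, ((if z = a then 1 else 0) * (if z = a' then 1 else 0) : ℝ) =
        if a = a' then 1 else 0 := by simp [eq_comm]
    rw [Fintype.sum_prod_type, ← h a a', ← h b b', Finset.sum_mul_sum]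
    exact Finset.sum_congr rfl fun _ _ => Finset.sum_congr rfl fun _ _ => mul_mul_mul_comm _ _ _ _
  have h2 : ∀ a b : Fin d, ∑ z : Fin d × Fin d,
      ((if z.1 = a then 1 else 0) * (if z.2 = b then 1 else 0) : ℝ) *
      (if z.1 = z.2 then 1 else 0) = if a = b then 1 else 0 := by
    intro a b
    simp only [Fintype.sum_prod_type, mul_assoc]
    simp [eq_comm]
  have h3 : ∑ z : Fin d × Fin d, ((if z.1 = z.2 then 1 else 0) : ℝ) * (if z.1 = z.2 then 1 else 0)
      = d := by
    simp [Fintype.sum_prod_type]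
  calc _ = ∑ z : Fin d × Fin d, ((((if z.1 = a then 1 else 0) * (if z.2 = b then 1 else 0) : ℝ) *
            ((if z.1 = a' then 1 else 0) * (if z.2 = b' then 1 else 0)) +
          c * (if a' = b' then 1 else 0) *
            (((if z.1 = a then 1 else 0) * (if z.2 = b then 1 else 0) : ℝ) *
              (if z.1 = z.2 then 1 else 0)) +
          c * (if a = b then 1 else 0) *
            (((if z.1 = a' then 1 else 0) * (if z.2 = b' then 1 else 0) : ℝ) *
              (if z.1 = z.2 then 1 else 0))) +
          c ^ 2 * (if a = b then 1 else 0) * (if a' = b' then 1 else 0) *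
            (((if z.1 = z.2 then 1 else 0) : ℝ) * (if z.1 = z.2 then 1 else 0))) :=
        Finset.sum_congr rfl fun z _ => by dsimp only; ring
    _ = _ := by
      simp only [Finset.sum_add_distrib, ← Finset.mul_sum, h1, h2, h3]
      linear_combination (if a = b then 1 else 0) * (if a' = b' then 1 else 0) * hc

section ptrace

variable {n : ℕ} {d : Fin n → ℕ}

lemma sum_eq_sum_mergeFun {M : Type*} [AddCommMonoid M] (J : Finset (Fin n))
    (φ : ((i : Fin n) → Fin (d i)) → M) :
    ∑ F, φ F = ∑ h, ∑ f, φ (mergeFun J h f) := by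
  rw [← Fintype.sum_prod_type' (fun h f => φ (mergeFun J h f))]
  exact ((Equiv.piEquivPiSubtypeProd (· ∈ J) fun i => Fin (d i)).symm.sum_comp φ).symm

lemma prod_boole_mergeFun (J : Finset (Fin n))
    (h h' : (i : {i : Fin n // i ∈ J}) → Fin (d i.1))
    (f f' : (i : {i : Fin n // i ∉ J}) → Fin (d i.1)) :
    ∏ k ∈ J, (if mergeFun J h f k = mergeFun J h' f' k then (1 : ℂ) else 0) =
      if h = h' then 1 else 0 := by
  rw [Finset.prod_ite_zero, Finset.prod_const_one]
  congr 1
  simp +contextual [mergeFun, funext_iff]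

lemma prod_compl_boole_mergeFun (J : Finset (Fin n))
    (h h' : (i : {i : Fin n // i ∈ J}) → Fin (d i.1))
    (f f' : (i : {i : Fin n // i ∉ J}) → Fin (d i.1)) :
    ∏ k ∈ Jᶜ, (if mergeFun J h f k = mergeFun J h' f' k then (1 : ℂ) else 0) =
      if f = f' then 1 else 0 := by
  rw [Finset.prod_ite_zero, Finset.prod_const_one]
  congr 1
  simp +contextual [mergeFun, funext_iff]

/-- The squared norm of a partial trace, as a quadratic form with a product kernel. -/
lemma frobSq_ptrace_eq_sum (J : Finset (Fin n))
    (C : Matrix ((i : Fin n) → Fin (d i)) ((i : Fin n) → Fin (d i)) ℂ) :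
    (frobSq (ptrace J C) : ℂ) = ∑ F, ∑ G, ∑ F', ∑ G', conj (C F G) * C F' G' *
      ((∏ k ∈ J, ((if F k = G k then 1 else 0) * (if F' k = G' k then 1 else 0))) *
        ∏ k ∈ Jᶜ, ((if F k = F' k then 1 else 0) * (if G k = G' k then 1 else 0))) := by
  have hJ : ∀ h f h₂ g h' f' h₂' g', conj (C (mergeFun J h f) (mergeFun J h₂ g)) *
      C (mergeFun J h' f') (mergeFun J h₂' g') *
      (((if h = h₂ then 1 else 0) * (if h' = h₂' then 1 else 0)) *
        ((if f = f' then 1 else 0) * (if g = g' then 1 else 0))) =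
      conj (C (mergeFun J h f) (mergeFun J h₂ g)) * (if h = h₂ then 1 else 0) *
        (C (mergeFun J h' f') (mergeFun J h₂' g') *
        (if f = f' then 1 else 0) * (if h' = h₂' then 1 else 0) * (if g = g' then 1 else 0)) := by
    intros; ring
  simp only [sum_eq_sum_mergeFun J, Finset.prod_mul_distrib, prod_boole_mergeFun,
    prod_compl_boole_mergeFun, hJ, ← Finset.mul_sum,
    Finset.sum_mul_boole, Finset.mem_univ, if_true]
  have hδ : ∀ h f, ∑ h₂, ∑ g, conj (C (mergeFun J h f) (mergeFun J h₂ g)) *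
      (if h = h₂ then 1 else 0) * ∑ i, C (mergeFun J i f) (mergeFun J i g) =
      ∑ g, conj (C (mergeFun J h f) (mergeFun J h g)) *
        ∑ i, C (mergeFun J i f) (mergeFun J i g) := by
    intro h f
    rw [Finset.sum_comm]
    refine Finset.sum_congr rfl fun g _ => ?_
    simp only [← Finset.sum_mul, Finset.sum_mul_boole, Finset.mem_univ, if_true]
  simp only [hδ]
  rw [Finset.sum_comm]
  simp only [frobSq, ptrace, Matrix.of_apply, Complex.ofReal_sum, Complex.ofReal_pow,
    ← Complex.conj_mul', map_sum]
  refine Finset.sum_congr rfl fun f _ => ?_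
  rw [Finset.sum_comm]
  exact Finset.sum_congr rfl fun g _ => Finset.sum_mul ..

end ptrace

/-- Every signed quadratic form `q_v(α, C)` associated to a universal state inversion is
nonnegative whenever `|α| ≤ 1 / max_i d_i`. -/
theorem signed_qForm_nonneg (n : ℕ) (hn : 1 ≤ n) (d : Fin n → ℕ) (hd : ∀ i, 1 ≤ d i)
    (s : Fin n → ℝ) (hs : ∀ i, s i = 1 ∨ s i = -1)
    (α : ℝ) (hα : |α| ≤ 1 / ((Finset.univ.sup d : ℕ) : ℝ))
    (C : Matrix ((i : Fin n) → Fin (d i)) ((i : Fin n) → Fin (d i)) ℂ) :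
    0 ≤ ∑ J : Finset (Fin n), α ^ J.card * (∏ k ∈ J, s k) * frobSq (ptrace J C) := by
  have hβ : ∀ k, -1 ≤ α * s k * d k := by
    intro k
    have hle : (d k : ℝ) ≤ ((Finset.univ.sup d : ℕ) : ℝ) := by
      exact_mod_cast Finset.le_sup (f := d) (Finset.mem_univ k)
    have hpos : (0 : ℝ) < d k := by exact_mod_cast hd k
    have hs1 : |s k| = 1 := by rcases hs k with h | h <;> simp [h]
    have habs : |α * s k * d k| ≤ 1 := by
      rw [abs_mul, abs_mul, hs1, mul_one, abs_of_pos hpos]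
      rw [le_div_iff₀ (hpos.trans_le hle)] at hα
      exact (mul_le_mul_of_nonneg_left hle (abs_nonneg α)).trans hα
    exact (abs_le.mp habs).1
  choose L hL using fun k => exists_gram_one_add_maxEntangled (hd k) (hβ k)
  have key := re_sum_prod_gram_nonneg
    (fun (x : ((i : Fin n) → Fin (d i)) × ((i : Fin n) → Fin (d i))) i => (x.1 i, x.2 i)) L
    (fun x => C x.1 x.2)
  convert key
  rw [← Complex.ofReal_re (∑ J : Finset (Fin n), _)]
  congr 1
  simp only [hL, Complex.ofReal_sum, Complex.ofReal_mul, frobSq_ptrace_eq_sum,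
    Complex.ofReal_add, Fintype.prod_add, Fintype.sum_prod_type, Finset.mul_sum]
  iterate 4
    rw [Finset.sum_comm]
    refine Finset.sum_congr rfl fun _ _ => ?_
  refine Finset.sum_congr rfl fun J _ => ?_
  simp only [Finset.prod_mul_distrib, Finset.prod_const, Complex.ofReal_pow, Complex.ofReal_prod,
    apply_ite Complex.ofReal, Complex.ofReal_one, Complex.ofReal_zero]
  ring
end

section
/- Let d₁, d₂ ≥ 1, let C : Matrix (Fin d₁ × Fin d₂) (Fin d₁ × Fin d₂) ℂ be nonzero with rank r, let d = max{d₁, d₂} and m = min{r, d}. Then |‖tr₁ C‖₂² − ‖tr₂ C‖₂²| ≤ m·‖C‖₂² − (1/m)·|tr C|². -/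
open Finset

/-- Partial trace over the first tensor factor. -/
noncomputable def ptr1 {d₁ d₂ : ℕ} (C : Matrix (Fin d₁ × Fin d₂) (Fin d₁ × Fin d₂) ℂ) :
    Matrix (Fin d₂) (Fin d₂) ℂ :=
  Matrix.of fun j j' => ∑ i, C (i, j) (i, j')

/-- Partial trace over the second tensor factor. -/
noncomputable def ptr2 {d₁ d₂ : ℕ} (C : Matrix (Fin d₁ × Fin d₂) (Fin d₁ × Fin d₂) ℂ) :
    Matrix (Fin d₁) (Fin d₁) ℂ :=
  Matrix.of fun i i' => ∑ j, C (i, j) (i', j)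

open ComplexConjugate

/-- For commuting involutions `u`, `v` of the index set, the operator `(1 + u) (1 - v)` is
positive semidefinite, being a quarter of its own square. -/
lemma re_sum_conj_mul_involution_nonneg {N : Type*} [Fintype N] (x : N → ℂ) (u v : N → N)
    (hu : Function.Involutive u) (hv : Function.Involutive v) (huv : ∀ n, u (v n) = v (u n)) :
    0 ≤ (∑ n, conj (x n) * (x n + x (u n) - x (v n) - x (u (v n)))).re := by
  have reindex (w : N → N) (hw : Function.Involutive w) (f : N → ℂ) :
      ∑ n, f (w n) = ∑ n, f n := Equiv.sum_comp hw.toPerm f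
  set g : N → ℂ := fun n => conj (x n) * (x n + x (u n) - x (v n) - x (u (v n))) with hg
  have key : 4 * ∑ n, g n =
      ∑ n, ((‖x n + x (u n) - x (v n) - x (u (v n))‖ ^ 2 : ℝ) : ℂ) := by
    have h1 := reindex u hu g
    have h2 := reindex v hv g
    have h3 : ∑ n, g (u (v n)) = ∑ n, g n := (reindex v hv fun n => g (u n)).trans h1
    calc 4 * ∑ n, g n = ∑ n, g n + ∑ n, g (u n) + ∑ n, g (v n) + ∑ n, g (u (v n)) := by
          rw [h1, h2, h3]; ring
      _ = _ := by
          rw [← sum_add_distrib, ← sum_add_distrib, ← sum_add_distrib]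
          refine sum_congr rfl fun n _ => ?_
          push_cast
          rw [← Complex.conj_mul']
          simp only [hg, huv, hu _, hv _, map_add, map_sub]
          ring
  have hre := congrArg Complex.re key
  rw [← Complex.ofReal_sum, Complex.ofReal_re] at hre
  have : (4 * ∑ n, g n).re = 4 * (∑ n, g n).re := by simp
  have hnn : 0 ≤ ∑ n, ‖x n + x (u n) - x (v n) - x (u (v n))‖ ^ 2 :=
    sum_nonneg fun _ _ => sq_nonneg _
  linarith

lemma ofReal_frobSq {m n : Type*} [Fintype m] [Fintype n] (M : Matrix m n ℂ) :
    (frobSq M : ℂ) = ∑ p, ∑ q, conj (M p q) * M p q := by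
  simp [frobSq, Complex.conj_mul']

/-- Entrywise form of the decomposition `C = ∑ k, |a k⟩⟨b k|` into `r` dyads. -/
def IsDyadSum {P : Type*} {r : ℕ} (C : Matrix P P ℂ) (a b : Fin r → P → ℂ) : Prop :=
  ∀ p q, C p q = ∑ k, a k p * conj (b k q)

lemma sum_rotate {α β κ : Type*} [Fintype α] [Fintype β] [Fintype κ] (f : α × β × κ → ℂ) :
    ∑ n, f n = ∑ k, ∑ i, ∑ j, f (i, j, k) := by
  rw [sum_comm, Fintype.sum_prod_type]
  refine sum_congr rfl fun i _ => ?_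
  rw [sum_comm, Fintype.sum_prod_type]

/-- The difference of the squared norms of the partial traces is controlled by any dyad
decomposition, with the squared overlaps `⟨b l, a k⟩` as a correction. -/
lemma abs_diff_add_overlap_le {d₁ d₂ r : ℕ} {C : Matrix (Fin d₁ × Fin d₂) (Fin d₁ × Fin d₂) ℂ}
    {a b : Fin r → Fin d₁ × Fin d₂ → ℂ} (h : IsDyadSum C a b) :
    |frobSq (ptr1 C) - frobSq (ptr2 C)| + ∑ k, ∑ l, ‖∑ p, a k p * conj (b l p)‖ ^ 2
      ≤ frobSq (Matrix.of a) * frobSq (Matrix.of b) := by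
  let N := (Fin d₁ × Fin d₁) × (Fin d₂ × Fin d₂) × (Fin r × Fin r)
  let x : N → ℂ := fun n => a n.2.2.1 (n.1.1, n.2.1.1) * b n.2.2.2 (n.1.2, n.2.1.2)
  let u : N → N := fun n => (n.1, n.2.1.swap, n.2.2.swap)
  let v : N → N := fun n => (n.1.swap, n.2.1, n.2.2.swap)
  have hu : Function.Involutive u := fun _ => rfl
  have hv : Function.Involutive v := fun _ => rfl
  have huv : ∀ n, u (v n) = v (u n) := fun _ => rfl
  have hxu : ∑ n, conj (x n) * x (u n) = frobSq (ptr2 C) := by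
    rw [ofReal_frobSq]
    simp only [ptr2, Matrix.of_apply, h _ _, map_sum, Fintype.sum_mul_sum,
      N, Fintype.sum_prod_type, x, u, Prod.swap]
    refine sum_congr rfl fun i _ => sum_congr rfl fun i' _ => sum_congr rfl fun j _ =>
      sum_congr rfl fun j' _ => sum_congr rfl fun k _ => sum_congr rfl fun l _ => ?_
    simp only [map_mul, Complex.conj_conj]
    ring
  have hxv : ∑ n, conj (x n) * x (v n) = frobSq (ptr1 C) := by
    rw [ofReal_frobSq]
    simp only [ptr1, Matrix.of_apply, h _ _, map_sum, Fintype.sum_mul_sum]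
    rw [Fintype.sum_prod_type]
    simp only [Fintype.sum_prod_type (α₁ := Fin d₂ × Fin d₂)]
    rw [sum_comm]
    simp only [Fintype.sum_prod_type, x, v, Prod.swap]
    refine sum_congr rfl fun j _ => sum_congr rfl fun j' _ => sum_congr rfl fun i _ =>
      sum_congr rfl fun i' _ => sum_congr rfl fun k _ => sum_congr rfl fun l _ => ?_
    simp only [map_mul, Complex.conj_conj]
    ring
  have hx : ∑ n, conj (x n) * x n = frobSq (Matrix.of a) * frobSq (Matrix.of b) := by
    rw [ofReal_frobSq, ofReal_frobSq, sum_rotate]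
    simp only [Fintype.sum_prod_type, x, Matrix.of_apply, Fintype.sum_mul_sum]
    refine sum_congr rfl fun k _ => sum_congr rfl fun l _ => sum_congr rfl fun i _ =>
      sum_congr rfl fun i' _ => sum_congr rfl fun j _ => sum_congr rfl fun j' _ => ?_
    simp only [map_mul]
    ring
  have hxuv : ∑ n, conj (x n) * x (u (v n)) =
      ((∑ k, ∑ l, ‖∑ p, a k p * conj (b l p)‖ ^ 2 : ℝ) : ℂ) := by
    push_cast
    simp only [← Complex.conj_mul']
    rw [sum_rotate]
    simp only [Fintype.sum_prod_type, x, u, v, Prod.swap, map_sum, Fintype.sum_mul_sum]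
    refine sum_congr rfl fun k _ => sum_congr rfl fun l _ => sum_congr rfl fun i _ =>
      sum_congr rfl fun i' _ => sum_congr rfl fun j _ => sum_congr rfl fun j' _ => ?_
    simp only [map_mul, Complex.conj_conj]
    ring
  have h1 := re_sum_conj_mul_involution_nonneg x u v hu hv huv
  have h2 := re_sum_conj_mul_involution_nonneg x v u hv hu fun n => (huv n).symm
  simp only [← huv] at h2
  simp only [mul_add, mul_sub, sum_add_distrib, sum_sub_distrib, hxu, hxv, hx, hxuv,
    ← Complex.ofReal_mul, ← Complex.ofReal_add, ← Complex.ofReal_sub, Complex.ofReal_re] at h1 h2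
  rw [← le_sub_iff_add_le, abs_le]
  constructor <;> linarith

/-- A matrix of rank `r` is a sum of `r` dyads whose left vectors are orthonormal. -/
lemma exists_isDyadSum {P : Type*} [Fintype P] [DecidableEq P] (C : Matrix P P ℂ) :
    ∃ a b : Fin C.rank → P → ℂ, IsDyadSum C a b ∧
      frobSq (Matrix.of a) = C.rank ∧ frobSq (Matrix.of b) = frobSq C := by
  let W := LinearMap.range (Matrix.toEuclideanLin C)
  have hW : Module.finrank ℂ W = C.rank := by
    rw [C.rank_eq_finrank_range_toLin (PiLp.basisFun 2 ℂ P) (PiLp.basisFun 2 ℂ P),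
      ← Matrix.toLpLin_eq_toLin]
  let e : OrthonormalBasis (Fin C.rank) ℂ W := (stdOrthonormalBasis ℂ W).reindex (finCongr hW)
  let c (q : P) : W := ⟨Matrix.toEuclideanLin C (EuclideanSpace.single q 1), ⟨_, rfl⟩⟩
  have hc (p q : P) : (c q : EuclideanSpace ℂ P) p = C p q := by
    simp [c]
  refine ⟨fun k p => (e k : EuclideanSpace ℂ P) p, fun k q => inner ℂ (c q) (e k), ?_, ?_, ?_⟩
  · intro p q
    have h := congrArg (fun w : W => (w : EuclideanSpace ℂ P) p) (e.sum_repr' (c q))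
    simp only [hc] at h
    rw [← h]
    simp [mul_comm]
  · have h (k : Fin C.rank) : ∑ p, ‖(e k : EuclideanSpace ℂ P) p‖ ^ 2 = 1 := by
      rw [← EuclideanSpace.norm_sq_eq, Submodule.norm_coe, e.norm_eq_one, one_pow]
    simp [frobSq, h]
  · simp only [frobSq, Matrix.of_apply]
    rw [sum_comm]
    conv_rhs => rw [sum_comm]
    refine sum_congr rfl fun q _ => ?_
    rw [e.sum_sq_norm_inner_left, ← Submodule.norm_coe, EuclideanSpace.norm_sq_eq]
    simp only [hc]

lemma norm_sum_sq_le {ι : Type*} [Fintype ι] (f : ι → ℂ) :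
    ‖∑ i, f i‖ ^ 2 ≤ Fintype.card ι * ∑ i, ‖f i‖ ^ 2 := by
  calc ‖∑ i, f i‖ ^ 2 ≤ (∑ i, ‖f i‖) ^ 2 := by gcongr; exact norm_sum_le _ _
    _ ≤ _ := sq_sum_le_card_mul_sum_sq

lemma norm_trace_sq_le {n : Type*} [Fintype n] (M : Matrix n n ℂ) :
    ‖M.trace‖ ^ 2 ≤ Fintype.card n * frobSq M := by
  refine (norm_sum_sq_le _).trans ?_
  gcongr
  exact sum_le_sum fun i _ =>
    single_le_sum (f := fun j => ‖M i j‖ ^ 2) (fun _ _ => sq_nonneg _) (mem_univ i)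

section PartialTraces

variable {d₁ d₂ : ℕ} (C : Matrix (Fin d₁ × Fin d₂) (Fin d₁ × Fin d₂) ℂ)

lemma trace_ptr1 : (ptr1 C).trace = C.trace := by
  simp [Matrix.trace, ptr1, Fintype.sum_prod_type_right]

lemma trace_ptr2 : (ptr2 C).trace = C.trace := by
  simp [Matrix.trace, ptr2, Fintype.sum_prod_type]

lemma frobSq_ptr1_le : frobSq (ptr1 C) ≤ d₁ * frobSq C := by
  calc frobSq (ptr1 C) ≤ ∑ j, ∑ j', d₁ * ∑ i, ‖C (i, j) (i, j')‖ ^ 2 :=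
        sum_le_sum fun j _ => sum_le_sum fun j' _ => by
          simpa [ptr1] using norm_sum_sq_le fun i => C (i, j) (i, j')
    _ = d₁ * ∑ i, ∑ j, ∑ j', ‖C (i, j) (i, j')‖ ^ 2 := by
        simp only [← mul_sum]
        rw [sum_comm (s := (univ : Finset (Fin d₁)))]
        congr 1
        exact sum_congr rfl fun j _ => sum_comm
    _ ≤ d₁ * frobSq C := by
        simp only [frobSq, Fintype.sum_prod_type]
        gcongr with i _ j _
        exact single_le_sum (f := fun i' => ∑ j', ‖C (i, j) (i', j')‖ ^ 2)
          (fun _ _ => sum_nonneg fun _ _ => sq_nonneg _) (mem_univ i)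

lemma frobSq_ptr2_le : frobSq (ptr2 C) ≤ d₂ * frobSq C := by
  calc frobSq (ptr2 C) ≤ ∑ i, ∑ i', d₂ * ∑ j, ‖C (i, j) (i', j)‖ ^ 2 :=
        sum_le_sum fun i _ => sum_le_sum fun i' _ => by
          simpa [ptr2] using norm_sum_sq_le fun j => C (i, j) (i', j)
    _ = d₂ * ∑ i, ∑ j, ∑ i', ‖C (i, j) (i', j)‖ ^ 2 := by
        simp only [← mul_sum]
        congr 1
        exact sum_congr rfl fun i _ => sum_comm
    _ ≤ d₂ * frobSq C := by
        simp only [frobSq, Fintype.sum_prod_type]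
        gcongr with i _ j _ i' _
        exact single_le_sum (f := fun j' => ‖C (i, j) (i', j')‖ ^ 2)
          (fun _ _ => sq_nonneg _) (mem_univ j)

lemma abs_diff_le_of_rank (hC : C ≠ 0) :
    |frobSq (ptr1 C) - frobSq (ptr2 C)|
      ≤ C.rank * frobSq C - (1 / C.rank) * ‖C.trace‖ ^ 2 := by
  obtain ⟨a, b, h, ha, hb⟩ := exists_isDyadSum C
  have hmain := abs_diff_add_overlap_le h
  rw [ha, hb] at hmain
  let G : Matrix (Fin C.rank) (Fin C.rank) ℂ := Matrix.of fun k l => ∑ p, a k p * conj (b l p)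
  have htr : G.trace = C.trace := by
    simp only [Matrix.trace, Matrix.diag, G, Matrix.of_apply, h _ _]
    exact sum_comm
  have hG := norm_trace_sq_le G
  rw [htr, Fintype.card_fin] at hG
  have hr : (0 : ℝ) < C.rank := by
    refine Nat.cast_pos.2 (Nat.pos_of_ne_zero fun h0 => hC ?_)
    have : IsEmpty (Fin C.rank) := by rw [h0]; infer_instance
    ext p q
    simp [h p q]
  have : (1 / C.rank) * ‖C.trace‖ ^ 2 ≤ frobSq G := by
    rw [one_div, inv_mul_le_iff₀ hr]
    exact hG
  have : frobSq G = ∑ k, ∑ l, ‖∑ p, a k p * conj (b l p)‖ ^ 2 := rfl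
  linarith

lemma abs_diff_le_max (hd₁ : 1 ≤ d₁) :
    |frobSq (ptr1 C) - frobSq (ptr2 C)|
      ≤ (max d₁ d₂ : ℝ) * frobSq C - (1 / (max d₁ d₂ : ℝ)) * ‖C.trace‖ ^ 2 := by
  have hN : 0 ≤ frobSq C := sum_nonneg fun _ _ => sum_nonneg fun _ _ => sq_nonneg _
  have h1 : 0 ≤ frobSq (ptr1 C) := sum_nonneg fun _ _ => sum_nonneg fun _ _ => sq_nonneg _
  have h2 : 0 ≤ frobSq (ptr2 C) := sum_nonneg fun _ _ => sum_nonneg fun _ _ => sq_nonneg _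
  have hd : (0 : ℝ) < max (d₁ : ℝ) d₂ := lt_max_of_lt_left (by exact_mod_cast hd₁)
  have t1 := norm_trace_sq_le (ptr1 C)
  have t2 := norm_trace_sq_le (ptr2 C)
  rw [trace_ptr1, Fintype.card_fin] at t1
  rw [trace_ptr2, Fintype.card_fin] at t2
  have s1 : (1 / max (d₁ : ℝ) d₂) * ‖C.trace‖ ^ 2 ≤ frobSq (ptr1 C) := by
    rw [one_div, inv_mul_le_iff₀ hd]
    exact t1.trans (by gcongr; exact le_max_right _ _)
  have s2 : (1 / max (d₁ : ℝ) d₂) * ‖C.trace‖ ^ 2 ≤ frobSq (ptr2 C) := by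
    rw [one_div, inv_mul_le_iff₀ hd]
    exact t2.trans (by gcongr; exact le_max_left _ _)
  have b1 : frobSq (ptr1 C) ≤ max (d₁ : ℝ) d₂ * frobSq C :=
    (frobSq_ptr1_le C).trans (by gcongr; exact le_max_left _ _)
  have b2 : frobSq (ptr2 C) ≤ max (d₁ : ℝ) d₂ * frobSq C :=
    (frobSq_ptr2_le C).trans (by gcongr; exact le_max_right _ _)
  rw [abs_le]
  constructor <;> linarith

end PartialTraces

/-- For a nonzero bipartite matrix `C` of rank `r`, with `m = min{r, max{d₁,d₂}}`,
`|‖tr₁C‖₂² − ‖tr₂C‖₂²| ≤ m‖C‖₂² − (1/m)|tr C|²`. -/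
theorem abs_diff_partial_traces_le (d₁ d₂ : ℕ) (hd₁ : 1 ≤ d₁) (hd₂ : 1 ≤ d₂)
    (C : Matrix (Fin d₁ × Fin d₂) (Fin d₁ × Fin d₂) ℂ) (hC : C ≠ 0) :
    |frobSq (ptr1 C) - frobSq (ptr2 C)|
      ≤ (min C.rank (max d₁ d₂) : ℝ) * frobSq C
        - (1 / (min C.rank (max d₁ d₂) : ℝ)) * ‖C.trace‖ ^ 2 := by
  rcases min_choice (C.rank : ℝ) (max d₁ d₂) with h | h <;> rw [h]
  · exact abs_diff_le_of_rank C hC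
  · exact abs_diff_le_max C hd₁
end

section
/- Let d₁, d₂ ≥ 1 and let C : Matrix (Fin d₁ × Fin d₂) (Fin d₁ × Fin d₂) ℂ be a nonzero positive semidefinite matrix of rank r. Then ‖tr₁ C‖₂² ≥ (1/r)·‖tr₂ C‖₂². -/
open Finset ComplexOrder

theorem frobSq_nonneg {m n : Type*} [Fintype m] [Fintype n] (M : Matrix m n ℂ) :
    0 ≤ frobSq M :=
  Finset.sum_nonneg fun _ _ => Finset.sum_nonneg fun _ _ => sq_nonneg _

theorem frobSq_eq_re_trace {m n : Type*} [Fintype m] [Fintype n] (M : Matrix m n ℂ) :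
    frobSq M = (M * M.conjTranspose).trace.re := by
  simp only [frobSq, Matrix.trace, Matrix.diag_apply, Matrix.mul_apply,
    Matrix.conjTranspose_apply, Complex.re_sum]
  refine Finset.sum_congr rfl fun p _ => Finset.sum_congr rfl fun q _ => ?_
  rw [← Complex.normSq_eq_norm_sq, ← Complex.ofReal_re (Complex.normSq _), ← Complex.mul_conj]
  rfl

/-- Cauchy–Schwarz bound for the squared Frobenius norm of a finite sum. -/
theorem frobSq_sum_le {ι m n : Type*} [Fintype m] [Fintype n] (s : Finset ι)
    (M : ι → Matrix m n ℂ) :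
    frobSq (∑ k ∈ s, M k) ≤ (s.card : ℝ) * ∑ k ∈ s, frobSq (M k) := by
  have key (p : m) (q : n) :
      ‖(∑ k ∈ s, M k) p q‖ ^ 2 ≤ (s.card : ℝ) * ∑ k ∈ s, ‖M k p q‖ ^ 2 := by
    rw [Matrix.sum_apply]
    exact (pow_le_pow_left₀ (norm_nonneg _) (norm_sum_le _ _) 2).trans
      (sq_sum_le_card_mul_sum_sq (s := s) (f := fun k => ‖M k p q‖))
  refine (Finset.sum_le_sum fun p _ => Finset.sum_le_sum fun q _ => key p q).trans_eq ?_
  simp only [frobSq, ← Finset.mul_sum]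
  rw [Finset.sum_comm (s := s)]
  simp only [Finset.sum_comm (s := s)]

/-- The squared Frobenius norm is superadditive on Gram matrices. -/
theorem sum_frobSq_mul_conjTranspose_le {ι m n : Type*} [Fintype m] [Fintype n]
    (s : Finset ι) (X : ι → Matrix m n ℂ) :
    ∑ k ∈ s, frobSq (X k * (X k).conjTranspose) ≤
      frobSq (∑ k ∈ s, X k * (X k).conjTranspose) := by
  classical
  induction s using Finset.induction_on with
  | empty => simpa using frobSq_nonneg _
  | insert a s ha ih =>
    rw [Finset.sum_insert ha, Finset.sum_insert ha]
    set S := ∑ k ∈ s, X k * (X k).conjTranspose with hS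
    have hpsd : S.PosSemidef :=
      Matrix.posSemidef_sum s fun k _ => Matrix.posSemidef_self_mul_conjTranspose (X k)
    have hcross : 0 ≤ (X a * (X a).conjTranspose * S).trace.re := by
      rw [Matrix.mul_assoc, Matrix.trace_mul_comm]
      exact (Complex.le_def.mp (hpsd.conjTranspose_mul_mul_same (X a)).trace_nonneg).1
    have hcross' : (S * (X a * (X a).conjTranspose)).trace.re =
        (X a * (X a).conjTranspose * S).trace.re := by rw [Matrix.trace_mul_comm]
    have hexp : frobSq (X a * (X a).conjTranspose + S) =
        frobSq (X a * (X a).conjTranspose) + frobSq S +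
          2 * (X a * (X a).conjTranspose * S).trace.re := by
      simp only [frobSq_eq_re_trace, Matrix.conjTranspose_add, Matrix.conjTranspose_mul,
        Matrix.conjTranspose_conjTranspose, hpsd.isHermitian.eq, Matrix.add_mul, Matrix.mul_add,
        Matrix.trace_add, Complex.add_re, hcross']
      ring
    linarith

theorem frobSq_transpose_mul_conjTranspose {m n : Type*} [Fintype m] [Fintype n]
    (A : Matrix m n ℂ) :
    frobSq (A.transpose * A.transpose.conjTranspose) = frobSq (A * A.conjTranspose) := by
  have hT : A.transpose.conjTranspose.transpose = A.conjTranspose := rfl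
  rw [frobSq_eq_re_trace, frobSq_eq_re_trace, ← Matrix.trace_transpose]
  simp only [Matrix.transpose_mul, Matrix.conjTranspose_mul, Matrix.conjTranspose_conjTranspose,
    Matrix.transpose_transpose, hT, Matrix.mul_assoc]
  rw [Matrix.trace_mul_comm]
  simp only [Matrix.mul_assoc]

/-- A positive semidefinite matrix is a sum of as many rank-one projections (up to scale)
as its rank. -/
theorem Matrix.PosSemidef.exists_eq_sum_mul_star {n : Type*} [Fintype n] {C : Matrix n n ℂ}
    (hC : C.PosSemidef) :
    ∃ (s : Finset n) (v : n → n → ℂ), s.card = C.rank ∧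
      ∀ p q, C p q = ∑ k ∈ s, v k p * star (v k q) := by
  classical
  obtain ⟨U, hU⟩ : ∃ U : Matrix n n ℂ,
      C = U * Matrix.diagonal (fun k => (hC.1.eigenvalues k : ℂ)) * U.conjTranspose :=
    ⟨hC.1.eigenvectorUnitary, hC.1.spectral_theorem⟩
  refine ⟨Finset.univ.filter fun k => hC.1.eigenvalues k ≠ 0,
    fun k p => U p k * (Real.sqrt (hC.1.eigenvalues k) : ℂ), ?_, fun p q => ?_⟩
  · rw [hC.1.rank_eq_card_non_zero_eigs, Fintype.card_subtype]
  · have hnonneg := hC.eigenvalues_nonneg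
    generalize hC.1.eigenvalues = μ at hU hnonneg ⊢
    have hspec : C p q = ∑ k, U p k * (μ k : ℂ) * star (U q k) := by
      rw [hU, Matrix.mul_apply]
      simp only [Matrix.mul_diagonal, Matrix.conjTranspose_apply]
    rw [hspec, Finset.sum_filter]
    refine Finset.sum_congr rfl fun k _ => ?_
    split_ifs with h
    · have hs : (Real.sqrt (μ k) : ℂ) * Real.sqrt (μ k) = μ k := by
        rw [← Complex.ofReal_mul, Real.mul_self_sqrt (hnonneg k)]
      simp only [← hs, star_mul', Complex.star_def, Complex.conj_ofReal]
      ring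
    · simp [not_not.mp h]

/-- For a nonzero positive semidefinite bipartite matrix `C` of rank `r`,
`‖tr₁ C‖₂² ≥ (1/r) ‖tr₂ C‖₂²`. -/
theorem ptr1_normSq_ge_inv_rank_mul_ptr2 (d₁ d₂ : ℕ) (hd₁ : 1 ≤ d₁) (hd₂ : 1 ≤ d₂)
    (C : Matrix (Fin d₁ × Fin d₂) (Fin d₁ × Fin d₂) ℂ)
    (hpsd : C.PosSemidef) (hC : C ≠ 0) :
    (1 / (C.rank : ℝ)) * frobSq (ptr2 C) ≤ frobSq (ptr1 C) := by
  obtain ⟨s, v, hcard, hv⟩ := hpsd.exists_eq_sum_mul_star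
  let A : Fin d₁ × Fin d₂ → Matrix (Fin d₁) (Fin d₂) ℂ := fun k => Matrix.of fun i j => v k (i, j)
  have h2 : ptr2 C = ∑ k ∈ s, A k * (A k).conjTranspose := by
    ext i i'
    simp only [ptr2, Matrix.of_apply, hv, Matrix.sum_apply, Matrix.mul_apply,
      Matrix.conjTranspose_apply, A]
    exact Finset.sum_comm
  have h1 : ptr1 C = ∑ k ∈ s, (A k).transpose * (A k).transpose.conjTranspose := by
    ext j j'
    simp only [ptr1, Matrix.of_apply, hv, Matrix.sum_apply, Matrix.mul_apply,
      Matrix.conjTranspose_apply, Matrix.transpose_apply, A]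
    exact Finset.sum_comm
  have hr : 0 < (C.rank : ℝ) := by
    have : C.rank ≠ 0 := fun h => hC (Matrix.ext fun p q => by
      rw [hv, Finset.card_eq_zero.mp (hcard.trans h)]
      simp)
    positivity
  rw [one_div, inv_mul_le_iff₀ hr, ← hcard, h1, h2]
  refine (frobSq_sum_le s _).trans (mul_le_mul_of_nonneg_left ?_ (Nat.cast_nonneg _))
  rw [← Finset.sum_congr rfl fun k _ => frobSq_transpose_mul_conjTranspose (A k)]
  exact sum_frobSq_mul_conjTranspose_le s _
end

section
/- Let d₁, d₂, d₃ ≥ 1 and let C : Matrix (Fin d₁ × Fin d₂ × Fin d₃) (Fin d₁ × Fin d₂ × Fin d₃) ℂ be a nonzero positive semidefinite matrix of rank r. Then ‖C‖₂² + (1/r)·(‖tr₁ C‖₂² − ‖tr₂ C‖₂² − ‖tr₃ C‖₂²) + (1/r²)·(−‖tr₁₂ C‖₂² − ‖tr₁₃ C‖₂² + ‖tr₂₃ C‖₂²) + (1/r³)·|tr C|² ≥ 0. (This is the positivity of the tripartite form q_{(0,1,1)} at parameter −1/r for positive semidefinite matrices.) -/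
open Finset ComplexOrder

/-- Partial trace over the first factor of a tripartite system. -/
noncomputable def tr1 {d₁ d₂ d₃ : ℕ} (C : Matrix (Fin d₁ × Fin d₂ × Fin d₃) (Fin d₁ × Fin d₂ × Fin d₃) ℂ) :
    Matrix (Fin d₂ × Fin d₃) (Fin d₂ × Fin d₃) ℂ :=
  Matrix.of fun p q => ∑ i, C (i, p.1, p.2) (i, q.1, q.2)

/-- Partial trace over the second factor of a tripartite system. -/
noncomputable def tr2 {d₁ d₂ d₃ : ℕ} (C : Matrix (Fin d₁ × Fin d₂ × Fin d₃) (Fin d₁ × Fin d₂ × Fin d₃) ℂ) :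
    Matrix (Fin d₁ × Fin d₃) (Fin d₁ × Fin d₃) ℂ :=
  Matrix.of fun p q => ∑ j, C (p.1, j, p.2) (q.1, j, q.2)

/-- Partial trace over the third factor of a tripartite system. -/
noncomputable def tr3 {d₁ d₂ d₃ : ℕ} (C : Matrix (Fin d₁ × Fin d₂ × Fin d₃) (Fin d₁ × Fin d₂ × Fin d₃) ℂ) :
    Matrix (Fin d₁ × Fin d₂) (Fin d₁ × Fin d₂) ℂ :=
  Matrix.of fun p q => ∑ k, C (p.1, p.2, k) (q.1, q.2, k)

/-- Partial trace over the first and second factors of a tripartite system. -/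
noncomputable def tr12 {d₁ d₂ d₃ : ℕ} (C : Matrix (Fin d₁ × Fin d₂ × Fin d₃) (Fin d₁ × Fin d₂ × Fin d₃) ℂ) :
    Matrix (Fin d₃) (Fin d₃) ℂ :=
  Matrix.of fun k k' => ∑ i, ∑ j, C (i, j, k) (i, j, k')

/-- Partial trace over the first and third factors of a tripartite system. -/
noncomputable def tr13 {d₁ d₂ d₃ : ℕ} (C : Matrix (Fin d₁ × Fin d₂ × Fin d₃) (Fin d₁ × Fin d₂ × Fin d₃) ℂ) :
    Matrix (Fin d₂) (Fin d₂) ℂ :=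
  Matrix.of fun j j' => ∑ i, ∑ k, C (i, j, k) (i, j', k)

/-- Partial trace over the second and third factors of a tripartite system. -/
noncomputable def tr23 {d₁ d₂ d₃ : ℕ} (C : Matrix (Fin d₁ × Fin d₂ × Fin d₃) (Fin d₁ × Fin d₂ × Fin d₃) ℂ) :
    Matrix (Fin d₁) (Fin d₁) ℂ :=
  Matrix.of fun i i' => ∑ j, ∑ k, C (i, j, k) (i', j, k)

open Matrix
open scoped Kronecker

namespace Matrix

section Hermitian

variable {n : Type*} [Fintype n]

lemma IsHermitian.ofReal_frobSq {M : Matrix n n ℂ} (hM : M.IsHermitian) :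
    (frobSq M : ℂ) = ∑ p, ∑ q, M p q * M q p := by
  simp only [frobSq, Complex.ofReal_sum, Complex.ofReal_pow]
  refine Finset.sum_congr rfl fun p _ => Finset.sum_congr rfl fun q _ => ?_
  rw [← hM.apply q p, ← Complex.mul_conj']
  rfl

lemma IsHermitian.ofReal_norm_trace_sq {M : Matrix n n ℂ} (hM : M.IsHermitian) :
    ((‖M.trace‖ ^ 2 : ℝ) : ℂ) = M.trace * M.trace := by
  have h : star M.trace = M.trace := by rw [← trace_conjTranspose, hM.eq]
  nth_rw 3 [← h]
  rw [Complex.ofReal_pow, ← Complex.mul_conj']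
  rfl

/-- Cauchy–Schwarz for the nonzero eigenvalues of a Hermitian matrix. -/
lemma IsHermitian.norm_trace_sq_le_rank_mul_frobSq [DecidableEq n] {M : Matrix n n ℂ}
    (hM : M.IsHermitian) : ‖M.trace‖ ^ 2 ≤ M.rank * frobSq M := by
  have hsq : frobSq M = ∑ i, hM.eigenvalues i ^ 2 := by
    have h1 : (frobSq M : ℂ) = (M * M).trace := by
      rw [hM.ofReal_frobSq]; rfl
    have h2 : (M * M).trace = ∑ i, ((hM.eigenvalues i : ℂ)) ^ 2 := by
      conv_lhs => rw [hM.spectral_theorem, ← map_mul, diagonal_mul_diagonal,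
        Unitary.conjStarAlgAut_apply, trace_mul_comm, ← mul_assoc]
      simp [trace_diagonal, pow_two]
    exact_mod_cast h1.trans h2
  have htr : ‖M.trace‖ ^ 2 = (∑ i, hM.eigenvalues i) ^ 2 := by
    have h : M.trace = ((∑ i, hM.eigenvalues i : ℝ) : ℂ) := by
      rw [hM.trace_eq_sum_eigenvalues]; simp
    rw [h, Complex.norm_real, Real.norm_eq_abs, sq_abs]
  rw [hsq, htr, hM.rank_eq_card_non_zero_eigs, Fintype.card_subtype,
    ← Finset.sum_filter_ne_zero, ← Finset.sum_filter_of_ne (p := fun i => hM.eigenvalues i ≠ 0)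
      (f := fun i => hM.eigenvalues i ^ 2) fun i _ h => by simpa using h]
  exact sq_sum_le_card_mul_sum_sq

end Hermitian

section Involution

variable {n : Type*} [Fintype n] [DecidableEq n]

/-- For commuting Hermitian involutions `P₁`, `P₂`, `P₃` and a sign `ε`, the product of
`1 + ε • P₁`, `1 - ε • P₂` and `1 - ε • P₃` is a nonnegative multiple of a projection, hence has
nonnegative expectation. -/
lemma PosSemidef.re_trace_mul_involution_prod_nonneg {K P₁ P₂ P₃ : Matrix n n ℂ} (hK : K.PosSemidef)
    (h₁ : P₁.IsHermitian) (h₂ : P₂.IsHermitian) (h₃ : P₃.IsHermitian)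
    (q₁ : P₁ * P₁ = 1) (q₂ : P₂ * P₂ = 1) (q₃ : P₃ * P₃ = 1)
    (c₁₂ : Commute P₁ P₂) (c₁₃ : Commute P₁ P₃) (c₂₃ : Commute P₂ P₃) (ε : ℝ) (hε : ε * ε = 1) :
    0 ≤ (K * ((1 + (ε : ℂ) • P₁) * ((1 - (ε : ℂ) • P₂) * (1 - (ε : ℂ) • P₃)))).trace.re := by
  have hεC : (ε : ℂ) * ε = 1 := by exact_mod_cast hε
  set A := 1 + (ε : ℂ) • P₁ with hA
  set B := 1 - (ε : ℂ) • P₂ with hB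
  set D := 1 - (ε : ℂ) • P₃ with hD
  have hAH : Aᴴ = A := by simp [hA, h₁.eq]
  have hBH : Bᴴ = B := by simp [hB, h₂.eq]
  have hDH : Dᴴ = D := by simp [hD, h₃.eq]
  have hAA : A * A = (2 : ℂ) • A := by
    simp only [hA, mul_add, add_mul, smul_mul_smul_comm, q₁, hεC, one_mul, mul_one, one_smul,
      two_smul]
    abel
  have hBB : B * B = (2 : ℂ) • B := by
    simp only [hB, mul_sub, sub_mul, smul_mul_smul_comm, q₂, hεC, one_mul, mul_one, one_smul,
      two_smul]
    abel
  have hDD : D * D = (2 : ℂ) • D := by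
    simp only [hD, mul_sub, sub_mul, smul_mul_smul_comm, q₃, hεC, one_mul, mul_one, one_smul,
      two_smul]
    abel
  have hAB : Commute A B :=
    (Commute.one_left _).add_left (((Commute.one_right _).sub_right (c₁₂.smul_right _)).smul_left _)
  have hAD : Commute A D :=
    (Commute.one_left _).add_left (((Commute.one_right _).sub_right (c₁₃.smul_right _)).smul_left _)
  have hBD : Commute B D :=
    (Commute.one_left _).sub_left (((Commute.one_right _).sub_right (c₂₃.smul_right _)).smul_left _)
  set Q := A * (B * D) with hQ
  have hQH : Qᴴ = Q := by
    rw [hQ, conjTranspose_mul, conjTranspose_mul, hAH, hBH, hDH, ← hBD.eq,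
      (hAB.mul_right hAD).eq]
  have hQQ : Q * Q = (8 : ℂ) • Q := by
    have h : Q * Q = (A * A) * ((B * B) * (D * D)) := by
      rw [hQ, (hAB.mul_right hAD).symm.mul_mul_mul_comm, hBD.symm.mul_mul_mul_comm]
    rw [h, hAA, hBB, hDD, smul_mul_smul_comm, smul_mul_smul_comm]
    norm_num [hQ]
  have h8 : (8 : ℂ) * (K * Q).trace = (Q * K * Qᴴ).trace := by
    rw [hQH, mul_assoc Q K Q, trace_mul_comm Q (K * Q), mul_assoc K Q Q, hQQ, mul_smul_comm,
      trace_smul, smul_eq_mul]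
  have h := (hK.mul_mul_conjTranspose_same Q).trace_nonneg
  rw [← h8] at h
  simpa using (Complex.le_def.1 h).1

end Involution

end Matrix

section FactorSwap

variable {α β γ : Type*}

/-- Exchange of the first factors of two copies of a triple product. -/
def swapFst : Equiv.Perm ((α × β × γ) × (α × β × γ)) :=
  Function.Involutive.toPerm (fun z => ((z.2.1, z.1.2), (z.1.1, z.2.2))) fun _ => rfl

/-- Exchange of the second factors of two copies of a triple product. -/
def swapSnd : Equiv.Perm ((α × β × γ) × (α × β × γ)) :=
  Function.Involutive.toPerm
    (fun z => ((z.1.1, z.2.2.1, z.1.2.2), (z.2.1, z.1.2.1, z.2.2.2))) fun _ => rfl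

/-- Exchange of the third factors of two copies of a triple product. -/
def swapThd : Equiv.Perm ((α × β × γ) × (α × β × γ)) :=
  Function.Involutive.toPerm
    (fun z => ((z.1.1, z.1.2.1, z.2.2.2), (z.2.1, z.2.2.1, z.1.2.2))) fun _ => rfl

end FactorSwap

lemma one_add_smul_mul_one_sub_smul_mul_one_sub_smul {R A : Type*} [CommRing R] [Ring A]
    [Algebra R A] {c : R} (hc : c * c = 1) (x y z : A) :
    (1 + c • x) * ((1 - c • y) * (1 - c • z)) =
      1 + c • (x - y - z) + (y * z - x * z - x * y) + c • (x * y * z) := by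
  simp only [mul_sub, sub_mul, add_mul, smul_mul_assoc, mul_smul_comm, smul_smul, hc, one_mul,
    mul_one, one_smul, smul_add, smul_sub, mul_assoc]
  abel

lemma Matrix.trace_mul_permMatrix {n : Type*} [Fintype n] [DecidableEq n] (K : Matrix n n ℂ)
    (σ : Equiv.Perm n) : (K * σ.permMatrix ℂ).trace = ∑ z, K z (σ.symm z) := by
  rw [Equiv.Perm.permMatrix, PEquiv.mul_toMatrix_toPEquiv]
  rfl

section PartialTrace

variable {d₁ d₂ d₃ : ℕ} {C : Matrix (Fin d₁ × Fin d₂ × Fin d₃) (Fin d₁ × Fin d₂ × Fin d₃) ℂ}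

lemma Matrix.IsHermitian.tr1 (hC : C.IsHermitian) : (tr1 C).IsHermitian :=
  .ext fun p q => by simp only [_root_.tr1, of_apply, star_sum, hC.apply]

lemma Matrix.IsHermitian.tr2 (hC : C.IsHermitian) : (tr2 C).IsHermitian :=
  .ext fun p q => by simp only [_root_.tr2, of_apply, star_sum, hC.apply]

lemma Matrix.IsHermitian.tr3 (hC : C.IsHermitian) : (tr3 C).IsHermitian :=
  .ext fun p q => by simp only [_root_.tr3, of_apply, star_sum, hC.apply]

lemma Matrix.IsHermitian.tr12 (hC : C.IsHermitian) : (tr12 C).IsHermitian :=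
  .ext fun p q => by simp only [_root_.tr12, of_apply, star_sum, hC.apply]

lemma Matrix.IsHermitian.tr13 (hC : C.IsHermitian) : (tr13 C).IsHermitian :=
  .ext fun p q => by simp only [_root_.tr13, of_apply, star_sum, hC.apply]

lemma Matrix.IsHermitian.tr23 (hC : C.IsHermitian) : (tr23 C).IsHermitian :=
  .ext fun p q => by simp only [_root_.tr23, of_apply, star_sum, hC.apply]

lemma ofReal_frobSq_tr1 (hC : C.IsHermitian) :
    (frobSq (tr1 C) : ℂ) = ((C ⊗ₖ C) * (swapSnd * swapThd : Equiv.Perm _).permMatrix ℂ).trace := by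
  rw [hC.tr1.ofReal_frobSq, trace_mul_permMatrix]
  simp only [tr1, of_apply, Finset.sum_mul, Finset.mul_sum, kroneckerMap_apply,
    ← Fintype.sum_prod_type']
  exact Fintype.sum_equiv
    ⟨fun ((j, k), (j', k'), i', i) => ((i, j, k), (i', j', k')),
      fun ((i, j, k), (i', j', k')) => ((j, k), (j', k'), i', i),
      fun _ => rfl, fun _ => rfl⟩ _ _ fun _ => rfl

lemma ofReal_frobSq_tr2 (hC : C.IsHermitian) :
    (frobSq (tr2 C) : ℂ) = ((C ⊗ₖ C) * (swapFst * swapThd : Equiv.Perm _).permMatrix ℂ).trace := by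
  rw [hC.tr2.ofReal_frobSq, trace_mul_permMatrix]
  simp only [tr2, of_apply, Finset.sum_mul, Finset.mul_sum, kroneckerMap_apply,
    ← Fintype.sum_prod_type']
  exact Fintype.sum_equiv
    ⟨fun ((i, k), (i', k'), j', j) => ((i, j, k), (i', j', k')),
      fun ((i, j, k), (i', j', k')) => ((i, k), (i', k'), j', j),
      fun _ => rfl, fun _ => rfl⟩ _ _ fun _ => rfl

lemma ofReal_frobSq_tr3 (hC : C.IsHermitian) :
    (frobSq (tr3 C) : ℂ) = ((C ⊗ₖ C) * (swapFst * swapSnd : Equiv.Perm _).permMatrix ℂ).trace := by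
  rw [hC.tr3.ofReal_frobSq, trace_mul_permMatrix]
  simp only [tr3, of_apply, Finset.sum_mul, Finset.mul_sum, kroneckerMap_apply,
    ← Fintype.sum_prod_type']
  exact Fintype.sum_equiv
    ⟨fun ((i, j), (i', j'), k', k) => ((i, j, k), (i', j', k')),
      fun ((i, j, k), (i', j', k')) => ((i, j), (i', j'), k', k),
      fun _ => rfl, fun _ => rfl⟩ _ _ fun _ => rfl

lemma ofReal_frobSq_tr12 (hC : C.IsHermitian) :
    (frobSq (tr12 C) : ℂ) = ((C ⊗ₖ C) * (swapThd : Equiv.Perm _).permMatrix ℂ).trace := by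
  rw [hC.tr12.ofReal_frobSq, trace_mul_permMatrix]
  simp only [tr12, of_apply, Finset.sum_mul, Finset.mul_sum, kroneckerMap_apply,
    ← Fintype.sum_prod_type']
  exact Fintype.sum_equiv
    ⟨fun (k, k', (i', j'), (i, j)) => ((i, j, k), (i', j', k')),
      fun ((i, j, k), (i', j', k')) => (k, k', (i', j'), (i, j)),
      fun _ => rfl, fun _ => rfl⟩ _ _ fun _ => rfl

lemma ofReal_frobSq_tr13 (hC : C.IsHermitian) :
    (frobSq (tr13 C) : ℂ) = ((C ⊗ₖ C) * (swapSnd : Equiv.Perm _).permMatrix ℂ).trace := by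
  rw [hC.tr13.ofReal_frobSq, trace_mul_permMatrix]
  simp only [tr13, of_apply, Finset.sum_mul, Finset.mul_sum, kroneckerMap_apply,
    ← Fintype.sum_prod_type']
  exact Fintype.sum_equiv
    ⟨fun (j, j', (i', k'), (i, k)) => ((i, j, k), (i', j', k')),
      fun ((i, j, k), (i', j', k')) => (j, j', (i', k'), (i, k)),
      fun _ => rfl, fun _ => rfl⟩ _ _ fun _ => rfl

lemma ofReal_frobSq_tr23 (hC : C.IsHermitian) :
    (frobSq (tr23 C) : ℂ) = ((C ⊗ₖ C) * (swapFst : Equiv.Perm _).permMatrix ℂ).trace := by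
  rw [hC.tr23.ofReal_frobSq, trace_mul_permMatrix]
  simp only [tr23, of_apply, Finset.sum_mul, Finset.mul_sum, kroneckerMap_apply,
    ← Fintype.sum_prod_type']
  exact Fintype.sum_equiv
    ⟨fun (i, i', (j', k'), (j, k)) => ((i, j, k), (i', j', k')),
      fun ((i, j, k), (i', j', k')) => (i, i', (j', k'), (j, k)),
      fun _ => rfl, fun _ => rfl⟩ _ _ fun _ => rfl

lemma ofReal_frobSq_kronecker (hC : C.IsHermitian) :
    (frobSq C : ℂ) =
      ((C ⊗ₖ C) * (swapFst * swapSnd * swapThd : Equiv.Perm _).permMatrix ℂ).trace := by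
  rw [hC.ofReal_frobSq, trace_mul_permMatrix]
  simp only [kroneckerMap_apply, ← Fintype.sum_prod_type']
  rfl

/-- The expectation of `(1 + ε F₁) (1 - ε F₂) (1 - ε F₃)` in `C ⊗ₖ C`, where `Fᵢ` swaps the `i`-th
tensor factors, is nonnegative for either sign `ε`. -/
lemma Matrix.PosSemidef.signed_sum_frobSq_partialTrace_nonneg (hC : C.PosSemidef) (ε : ℝ)
    (hε : ε * ε = 1) :
    0 ≤ ‖C.trace‖ ^ 2 + ε * (frobSq (_root_.tr23 C) - frobSq (_root_.tr13 C)
        - frobSq (_root_.tr12 C)) + (frobSq (_root_.tr1 C) - frobSq (_root_.tr2 C)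
        - frobSq (_root_.tr3 C)) + ε * frobSq C := by
  have hH := hC.isHermitian
  have e1 := ofReal_frobSq_tr1 hH
  have e2 := ofReal_frobSq_tr2 hH
  have e3 := ofReal_frobSq_tr3 hH
  have e12 := ofReal_frobSq_tr12 hH
  have e13 := ofReal_frobSq_tr13 hH
  have e23 := ofReal_frobSq_tr23 hH
  have e0 := ofReal_frobSq_kronecker hH
  have et : ((‖C.trace‖ ^ 2 : ℝ) : ℂ) = (C ⊗ₖ C).trace := by
    rw [hH.ofReal_norm_trace_sq, trace_kronecker]
  rw [permMatrix_mul] at e1 e2 e3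
  rw [permMatrix_mul, permMatrix_mul] at e0
  have herm (σ : Equiv.Perm ((Fin d₁ × Fin d₂ × Fin d₃) × (Fin d₁ × Fin d₂ × Fin d₃)))
      (h : σ⁻¹ = σ) : (σ.permMatrix ℂ).IsHermitian := by
    rw [IsHermitian, conjTranspose_permMatrix, h]
  have invol (σ : Equiv.Perm ((Fin d₁ × Fin d₂ × Fin d₃) × (Fin d₁ × Fin d₂ × Fin d₃)))
      (h : σ * σ = 1) : σ.permMatrix ℂ * σ.permMatrix ℂ = 1 := by
    rw [← permMatrix_mul, h, permMatrix_one]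
  have comm (σ τ : Equiv.Perm ((Fin d₁ × Fin d₂ × Fin d₃) × (Fin d₁ × Fin d₂ × Fin d₃)))
      (h : τ * σ = σ * τ) : Commute (σ.permMatrix ℂ) (τ.permMatrix ℂ) := by
    rw [Commute, SemiconjBy, ← permMatrix_mul, h, permMatrix_mul]
  have c₁₂ := comm swapFst swapSnd rfl
  have c₁₃ := comm swapFst swapThd rfl
  have c₂₃ := comm swapSnd swapThd rfl
  have key := (hC.kronecker hC).re_trace_mul_involution_prod_nonneg (herm swapFst rfl)
    (herm swapSnd rfl) (herm swapThd rfl) (invol swapFst rfl) (invol swapSnd rfl)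
    (invol swapThd rfl) c₁₂ c₁₃ c₂₃ ε hε
  rw [← c₂₃.eq] at e1
  rw [← c₁₃.eq] at e2
  rw [← c₁₂.eq] at e3
  rw [← c₁₂.eq, (c₁₃.symm.mul_right c₂₃.symm).eq] at e0
  have hεC : (ε : ℂ) * ε = 1 := by exact_mod_cast hε
  rw [one_add_smul_mul_one_sub_smul_mul_one_sub_smul hεC] at key
  simp only [mul_add, mul_sub, mul_smul_comm, mul_one, trace_add, trace_sub, trace_smul,
    ← e0, ← e1, ← e2, ← e3, ← e12, ← e13, ← e23, ← et, smul_eq_mul] at key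
  rw [mul_sub, mul_sub]
  exact_mod_cast key

end PartialTrace

/-- Positivity of the tripartite form `q_{(0,1,1)}` at parameter `-1/r` for nonzero
positive semidefinite matrices of rank `r`. -/
theorem q011_at_neg_inv_rank_nonneg (d₁ d₂ d₃ : ℕ) (h₁ : 1 ≤ d₁) (h₂ : 1 ≤ d₂) (h₃ : 1 ≤ d₃)
    (C : Matrix (Fin d₁ × Fin d₂ × Fin d₃) (Fin d₁ × Fin d₂ × Fin d₃) ℂ)
    (hpsd : C.PosSemidef) (hC : C ≠ 0) :
    0 ≤ frobSq C + (1 / (C.rank : ℝ)) * (frobSq (tr1 C) - frobSq (tr2 C) - frobSq (tr3 C))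
        + (1 / (C.rank : ℝ) ^ 2) * (-frobSq (tr12 C) - frobSq (tr13 C) + frobSq (tr23 C))
        + (1 / (C.rank : ℝ) ^ 3) * ‖C.trace‖ ^ 2 := by
  have hrank := hpsd.isHermitian.norm_trace_sq_le_rank_mul_frobSq
  have hpos := hpsd.signed_sum_frobSq_partialTrace_nonneg 1 (by norm_num)
  have hneg := hpsd.signed_sum_frobSq_partialTrace_nonneg (-1) (by norm_num)
  have hr : 1 ≤ (C.rank : ℝ) := by
    have : C.rank ≠ 0 := fun h => hC <| hpsd.trace_eq_zero_iff.1 <| by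
      simpa [h, pow_eq_zero_iff, sq_nonpos_iff] using hrank
    exact_mod_cast Nat.one_le_iff_ne_zero.2 this
  simp only [← _root_.one_div_pow]
  have hβr : 1 / (C.rank : ℝ) * C.rank = 1 := by field_simp
  have hβ0 : 0 ≤ 1 / (C.rank : ℝ) := by positivity
  have hβ1 : 1 / (C.rank : ℝ) ≤ 1 := div_le_one_of_le₀ hr (by positivity)
  generalize 1 / (C.rank : ℝ) = β at *
  have hC2 : 0 ≤ frobSq C - β * ‖C.trace‖ ^ 2 := by
    have := mul_le_mul_of_nonneg_left hrank hβ0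
    rw [← mul_assoc, hβr] at this
    linarith
  have t1 := mul_nonneg (by nlinarith : 0 ≤ 1 - β ^ 2) hC2
  have t2 := mul_nonneg (by positivity : 0 ≤ β * (1 + β) / 2) hpos
  have t3 := mul_nonneg (by nlinarith : 0 ≤ β * (1 - β) / 2) hneg
  linarith
end
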